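/- Limit of the creation operator to the Calogero creation operator: for every nonnegative integer n, real α>−1 and real x ≠ 0, lim_{q→1⁻} (1−q²)^{(α+1)/2} · (q^{2α+3/2}/(√(1−q)·√(1−q²)·x)) · [ √(1+q^{−2α−1}(1−q²)x²) · φ_n^α(q√(1−q²)x ; q) − q^{−(2α+1)θ(n)} · φ_n^α(√(1−q²)x ; q) ] = (1/√2) · [ −(φ_n^{α+1/2})'(x) − ((α+1/2)/x)(φ_n^{α+1/2}(x) − φ_n^{α+1/2}(−x)) + x·φ_n^{α+1/2}(x) ], where θ(n)=1 if n is odd and θ(n)=0 if n is even. -/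

import Mathlib

open scoped BigOperators
open Real Filter

noncomputable section

/-- q-shifted factorial `(a;q)_n`. -/
def qPoch (a q : ℝ) (n : ℕ) : ℝ := ∏ k ∈ Finset.range n, (1 - a * q ^ k)

/-- infinite q-shifted factorial `(a;q)_∞`. -/
def qPochInf (a q : ℝ) : ℝ := ∏' k : ℕ, (1 - a * q ^ k)

/-- q-number `⟦x⟧_q = (1-q^x)/(1-q)`. -/
def qNumber (q x : ℝ) : ℝ := (1 - q ^ x) / (1 - q)

/-- generalized q-integer `⟦n⟧_{q,α}`: equals `⟦n⟧_q` for even `n` and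
`⟦n+2α+1⟧_q` for odd `n` (so `⟦2m+1⟧_{q,α} = ⟦2m+2α+2⟧_q`). -/
def qNumAlpha (q α : ℝ) (n : ℕ) : ℝ :=
  if n % 2 = 0 then qNumber q n else qNumber q (n + 2 * α + 1)

/-- generalized q-factorial `n!_{q,α}`. -/
def qFactAlpha (q α : ℝ) (n : ℕ) : ℝ := ∏ k ∈ Finset.range n, qNumAlpha q α (k + 1)

/-- generalized q-shifted factorial `(q;q)_{n,α} = (1-q)^n n!_{q,α}`. -/
def qPochAlpha (q α : ℝ) (n : ℕ) : ℝ := (1 - q) ^ n * qFactAlpha q α n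

/-- generalized discrete q-Hermite II polynomials `h̃_{n,α}(x;q)`. -/
def hTilde (q α : ℝ) (n : ℕ) (x : ℝ) : ℝ :=
  qPoch q q n * ∑ k ∈ Finset.range (n / 2 + 1),
    (-1 : ℝ) ^ k * q ^ ((k * (2 * k + 1) : ℤ) - (2 * n * k : ℤ)) * x ^ (n - 2 * k) /
      (qPoch (q ^ 2) (q ^ 2) k * qPochAlpha q α (n - 2 * k))

/-- the weight `ω_α(x;q) = e_{q²}(-q^{-2α-1}x²) = 1/∏_{k≥0}(1+q^{-2α-1}x²q^{2k})`. -/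
def omegaAlpha (q α x : ℝ) : ℝ :=
  (∏' k : ℕ, (1 + q ^ (-(2 * α + 1)) * x ^ 2 * q ^ (2 * k)))⁻¹

/-- normalization constant `c_α`. -/
def cAlpha (q α : ℝ) : ℝ :=
  Real.sqrt (qPochInf (-q ^ (-(2 * α + 1))) (q ^ 2) * qPochInf (-q ^ (2 * α + 3)) (q ^ 2) *
      qPochInf (q ^ (2 * α + 2)) (q ^ 2) /
    (2 * (1 - q) *
      (qPochInf (-q) (q ^ 2) * qPochInf (-q) (q ^ 2) * qPochInf (q ^ 2) (q ^ 2))))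

/-- normalization constant `d_{n,α} = c_α q^{n²/2} (q;q)_{n,α}^{1/2} / (q;q)_n`. -/
def dAlpha (q α : ℝ) (n : ℕ) : ℝ :=
  cAlpha q α * q ^ (((n : ℝ) ^ 2) / 2) * Real.sqrt (qPochAlpha q α n) / qPoch q q n

/-- the (q,α)-deformed Hermite functions `φ_n^α(x;q)`. -/
def phiQ (q α : ℝ) (n : ℕ) (x : ℝ) : ℝ :=
  dAlpha q α n * Real.sqrt (omegaAlpha q α x) * hTilde q α n x

/-- parity indicator `θ(n)`: 1 if `n` is odd, 0 if `n` is even. -/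
def theta (n : ℕ) : ℝ := if n % 2 = 1 then 1 else 0

/-- the q-Gamma function `Γ_q(z) = (q;q)_∞ / (q^z;q)_∞ · (1-q)^{1-z}`. -/
def qGammaF (q z : ℝ) : ℝ := qPochInf q q / qPochInf (q ^ z) q * (1 - q) ^ (1 - z)

/-- Rosenblum generalized factorial `γ_ν(n)`. -/
def gammaGen (ν : ℝ) (n : ℕ) : ℝ :=
  2 ^ n * (Nat.factorial (n / 2) : ℝ) *
    Real.Gamma (ν + (((n + 1) / 2 : ℕ) : ℝ) + 1 / 2) / Real.Gamma (ν + 1 / 2)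

/-- generalized Hermite polynomials `H_n^ν(x)`. -/
def HGen (ν : ℝ) (n : ℕ) (x : ℝ) : ℝ :=
  (Nat.factorial n : ℝ) * ∑ k ∈ Finset.range (n / 2 + 1),
    (-1 : ℝ) ^ k * (2 * x) ^ (n - 2 * k) / ((Nat.factorial k : ℝ) * gammaGen ν (n - 2 * k))

/-- Rosenblum generalized Hermite functions `φ_n^ν(x)`. -/
def phiGen (ν : ℝ) (n : ℕ) (x : ℝ) : ℝ :=
  Real.sqrt (gammaGen ν n / Real.Gamma (ν + 1 / 2)) * Real.exp (-x ^ 2 / 2) *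
    HGen ν n x / ((2 : ℝ) ^ ((n : ℝ) / 2) * (Nat.factorial n : ℝ))

/-- symmetric q-number `[x]_s = (s^x - s^{-x})/(s - s^{-1})`. -/
def qNumSym (s x : ℝ) : ℝ := (s ^ x - s ^ (-x)) / (s - s⁻¹)

/-- Euler q-exponential `e_q(z) = Σ z^k/(q;q)_k`. -/
def eExp (q z : ℝ) : ℝ := ∑' k : ℕ, z ^ k / qPoch q q k

/-- generalized q-exponential `E_{q,α}(z) = Σ q^{k(k-1)/2} z^k/(q;q)_{k,α}`. -/
def bigEAlpha (q α z : ℝ) : ℝ := ∑' k : ℕ, q ^ (k * (k - 1) / 2) * z ^ k / qPochAlpha q α k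

/-- generalized q-exponential `e_{q,α}(z) = Σ z^k/(q;q)_{k,α}`. -/
def eExpAlpha (q α z : ℝ) : ℝ := ∑' k : ℕ, z ^ k / qPochAlpha q α k

lemma qp_summable (a : ℝ) {Q : ℝ} (h0 : 0 < Q) (h1 : Q < 1) :
    Summable (fun k : ℕ => -(a * Q ^ k)) :=
  ((summable_geometric_of_lt_one h0.le h1).mul_left a).neg

lemma qp_mult (a : ℝ) {Q : ℝ} (h0 : 0 < Q) (h1 : Q < 1) :
    Multipliable (fun k : ℕ => 1 - a * Q ^ k) := by
  simpa [sub_eq_add_neg] using Real.multipliable_one_add_of_summable (qp_summable a h0 h1)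

lemma qp_factor_pos {a Q : ℝ} (ha : a < 1) (h0 : 0 < Q) (h1 : Q < 1) (k : ℕ) :
    0 < 1 - a * Q ^ k := by
  have h2 : Q ^ k ≤ 1 := pow_le_one₀ h0.le h1.le
  have h3 : 0 < Q ^ k := pow_pos h0 k
  nlinarith

lemma qp_exp {a Q : ℝ} (ha : a < 1) (h0 : 0 < Q) (h1 : Q < 1) :
    Real.exp (∑' k : ℕ, Real.log (1 - a * Q ^ k)) = qPochInf a Q := by
  unfold qPochInf
  apply Real.rexp_tsum_eq_tprod (qp_factor_pos ha h0 h1)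
  simpa [sub_eq_add_neg] using Real.summable_log_one_add_of_summable (qp_summable a h0 h1)

lemma qp_pos {a Q : ℝ} (ha : a < 1) (h0 : 0 < Q) (h1 : Q < 1) : 0 < qPochInf a Q := by
  rw [← qp_exp ha h0 h1]; exact Real.exp_pos _

lemma qp_rec (a : ℝ) {Q : ℝ} (h0 : 0 < Q) (h1 : Q < 1) :
    qPochInf a Q = (1 - a) * qPochInf (a * Q) Q := by
  have h : ∀ k : ℕ, 1 - a * Q ^ (k + 1) = 1 - a * Q * Q ^ k := fun k => by ring
  unfold qPochInf
  rw [tprod_eq_zero_mul' (f := fun k : ℕ => 1 - a * Q ^ k)]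
  · simp [h]
  · simp only [h]; exact qp_mult _ h0 h1

lemma qp_tendsto (a : ℝ) {Q : ℝ} (h0 : 0 < Q) (h1 : Q < 1) :
    Tendsto (fun N => ∏ k ∈ Finset.range N, (1 - a * Q ^ k)) atTop (nhds (qPochInf a Q)) :=
  (qp_mult a h0 h1).hasProd.tendsto_prod_nat

lemma holder_minus {A B t : ℝ} (hA : 0 ≤ A) (hB : 0 ≤ B) (hA1 : A ≤ 1) (hB1 : B ≤ 1)
    (ht0 : 0 ≤ t) (ht1 : t ≤ 1) :
    (1 - A) ^ (1 - t) * (1 - B) ^ t ≤ 1 - A ^ (1 - t) * B ^ t := by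
  have e1 := Real.geom_mean_le_arith_mean2_weighted (sub_nonneg.2 ht1) ht0 hA hB (by ring)
  have e2 := Real.geom_mean_le_arith_mean2_weighted (sub_nonneg.2 ht1) ht0
    (sub_nonneg.2 hA1) (sub_nonneg.2 hB1) (by ring)
  nlinarith

lemma holder_plus {A B t : ℝ} (hA : 0 ≤ A) (hB : 0 ≤ B)
    (ht0 : 0 ≤ t) (ht1 : t ≤ 1) :
    1 + A ^ (1 - t) * B ^ t ≤ (1 + A) ^ (1 - t) * (1 + B) ^ t := by
  have a1 : 0 < 1 + A := by linarith
  have b1 : 0 < 1 + B := by linarith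
  have e1 := Real.geom_mean_le_arith_mean2_weighted (sub_nonneg.2 ht1) ht0
    (div_nonneg hA a1.le) (div_nonneg hB b1.le) (by ring)
  have e2 := Real.geom_mean_le_arith_mean2_weighted (sub_nonneg.2 ht1) ht0
    (div_nonneg zero_le_one a1.le) (div_nonneg zero_le_one b1.le) (by ring)
  rw [Real.div_rpow hA a1.le, Real.div_rpow hB b1.le] at e1
  rw [Real.div_rpow zero_le_one a1.le, Real.div_rpow zero_le_one b1.le, Real.one_rpow,
    Real.one_rpow] at e2
  have p1 : 0 < (1 + A) ^ (1 - t) := Real.rpow_pos_of_pos a1 _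
  have p2 : 0 < (1 + B) ^ t := Real.rpow_pos_of_pos b1 _
  have e3 : (1 + A ^ (1 - t) * B ^ t) / ((1 + A) ^ (1 - t) * (1 + B) ^ t) ≤ 1 := by
    calc _ = A ^ (1 - t) / (1 + A) ^ (1 - t) * (B ^ t / (1 + B) ^ t)
          + 1 / (1 + A) ^ (1 - t) * (1 / (1 + B) ^ t) := by field_simp; ring
      _ ≤ _ := add_le_add e1 e2
      _ = 1 := by field_simp; ring
  rwa [div_le_one (by positivity)] at e3

lemma geo_split {A B Q t : ℝ} (hA : 0 < A) (hB : 0 < B) (h0 : 0 < Q) (k : ℕ) :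
    (A * Q ^ k) ^ (1 - t) * (B * Q ^ k) ^ t = A ^ (1 - t) * B ^ t * Q ^ k := by
  have hk : 0 < Q ^ k := pow_pos h0 k
  rw [Real.mul_rpow hA.le hk.le, Real.mul_rpow hB.le hk.le]
  have : (Q ^ k) ^ (1 - t) * (Q ^ k) ^ t = Q ^ k := by
    rw [← Real.rpow_add hk]; simp
  calc _ = A ^ (1 - t) * B ^ t * ((Q ^ k) ^ (1 - t) * (Q ^ k) ^ t) := by ring
    _ = _ := by rw [this]

lemma qp_holder_minus {A B t Q : ℝ} (hA : 0 < A) (hB : 0 < B) (hA1 : A < 1) (hB1 : B < 1)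
    (ht0 : 0 ≤ t) (ht1 : t ≤ 1) (h0 : 0 < Q) (h1 : Q < 1) :
    qPochInf A Q ^ (1 - t) * qPochInf B Q ^ t ≤ qPochInf (A ^ (1 - t) * B ^ t) Q := by
  have l1 := (qp_tendsto A h0 h1).rpow_const (p := 1 - t) (Or.inr (by linarith))
  have l2 := (qp_tendsto B h0 h1).rpow_const (p := t) (Or.inr ht0)
  refine le_of_tendsto_of_tendsto' (l1.mul l2) (qp_tendsto _ h0 h1) fun N => ?_
  rw [← Real.finsetProd_rpow _ _ (fun i _ => (qp_factor_pos hA1 h0 h1 i).le),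
    ← Real.finsetProd_rpow _ _ (fun i _ => (qp_factor_pos hB1 h0 h1 i).le),
    ← Finset.prod_mul_distrib]
  refine Finset.prod_le_prod (fun i _ => ?_) (fun i _ => ?_)
  · exact mul_nonneg (Real.rpow_nonneg (qp_factor_pos hA1 h0 h1 i).le _)
      (Real.rpow_nonneg (qp_factor_pos hB1 h0 h1 i).le _)
  · have := holder_minus (A := A * Q ^ i) (B := B * Q ^ i) (by positivity) (by positivity)
      (by linarith [qp_factor_pos hA1 h0 h1 i]) (by linarith [qp_factor_pos hB1 h0 h1 i]) ht0 ht1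
    rwa [geo_split hA hB h0] at this

lemma qp_holder_plus {A B t Q : ℝ} (hA : 0 < A) (hB : 0 < B)
    (ht0 : 0 ≤ t) (ht1 : t ≤ 1) (h0 : 0 < Q) (h1 : Q < 1) :
    qPochInf (-(A ^ (1 - t) * B ^ t)) Q ≤ qPochInf (-A) Q ^ (1 - t) * qPochInf (-B) Q ^ t := by
  have l1 := (qp_tendsto (-A) h0 h1).rpow_const (p := 1 - t) (Or.inr (by linarith))
  have l2 := (qp_tendsto (-B) h0 h1).rpow_const (p := t) (Or.inr ht0)
  refine le_of_tendsto_of_tendsto' (qp_tendsto _ h0 h1) (l1.mul l2) fun N => ?_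
  have hA1 : -A < 1 := by linarith
  have hB1 : -B < 1 := by linarith
  have hc : 0 < A ^ (1 - t) * B ^ t :=
    mul_pos (Real.rpow_pos_of_pos hA _) (Real.rpow_pos_of_pos hB _)
  rw [← Real.finsetProd_rpow _ _ (fun i _ => (qp_factor_pos hA1 h0 h1 i).le),
    ← Real.finsetProd_rpow _ _ (fun i _ => (qp_factor_pos hB1 h0 h1 i).le),
    ← Finset.prod_mul_distrib]
  refine Finset.prod_le_prod (fun i _ => (qp_factor_pos (by linarith) h0 h1 i).le) (fun i _ => ?_)
  have := holder_plus (A := A * Q ^ i) (B := B * Q ^ i) (by positivity) (by positivity) ht0 ht1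
  rw [geo_split hA hB h0] at this
  simpa using this

/-- The one-sided filter. -/
lemma ev_Ioo : ∀ᶠ q : ℝ in nhdsWithin 1 (Set.Ioo 0 1), 0 < q ∧ q < 1 :=
  eventually_mem_nhdsWithin

lemma tendsto_id_one : Tendsto (fun q : ℝ => q) (nhdsWithin 1 (Set.Ioo 0 1)) (nhds 1) :=
  tendsto_id.mono_left nhdsWithin_le_nhds

lemma tendsto_rpow_one (s : ℝ) :
    Tendsto (fun q : ℝ => q ^ s) (nhdsWithin 1 (Set.Ioo 0 1)) (nhds 1) := by
  simpa using tendsto_id_one.rpow_const (p := s) (Or.inl one_ne_zero)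

lemma tendsto_sq_within : Tendsto (fun q : ℝ => q ^ 2) (nhdsWithin 1 (Set.Ioo 0 1))
    (nhdsWithin 1 (Set.Ioo 0 1)) := by
  refine tendsto_nhdsWithin_iff.2 ⟨by simpa using tendsto_id_one.pow 2, ?_⟩
  filter_upwards [ev_Ioo] with q hq
  exact ⟨pow_pos hq.1 2, pow_lt_one₀ hq.1.le hq.2 two_ne_zero⟩

lemma tendsto_qNumber (s : ℝ) :
    Tendsto (fun q : ℝ => qNumber q s) (nhdsWithin 1 (Set.Ioo 0 1)) (nhds s) := by
  have h : HasDerivAt (fun q : ℝ => q ^ s) s 1 := by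
    simpa using Real.hasDerivAt_rpow_const (x := 1) (p := s) (Or.inl one_ne_zero)
  have h2 := (hasDerivAt_iff_tendsto_slope.1 h).mono_left
    (nhdsWithin_mono (1 : ℝ) (s := Set.Ioo 0 1) (t := {1}ᶜ) (fun q hq => by
      simpa using hq.2.ne))
  refine h2.congr' ?_
  filter_upwards [ev_Ioo] with q hq
  simp only [slope_def_field, qNumber, Real.one_rpow]
  rw [← neg_div_neg_eq]; ring_nf

/-- `F(s+1)` from `F(s)`. -/
lemma F_rec (s : ℝ) {Q : ℝ} (h0 : 0 < Q) (h1 : Q < 1) :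
    qPochInf (Q ^ s) Q = (1 - Q ^ s) * qPochInf (Q ^ (s + 1)) Q := by
  rw [qp_rec _ h0 h1, Real.rpow_add h0, Real.rpow_one]

lemma H_rec (s : ℝ) {Q : ℝ} (h0 : 0 < Q) (h1 : Q < 1) :
    qPochInf (-Q ^ s) Q = (1 + Q ^ s) * qPochInf (-Q ^ (s + 1)) Q := by
  rw [qp_rec _ h0 h1, Real.rpow_add h0, Real.rpow_one]; congr 1 <;> ring_nf

lemma H_pos (s : ℝ) {Q : ℝ} (h0 : 0 < Q) (h1 : Q < 1) : 0 < qPochInf (-Q ^ s) Q :=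
  qp_pos (by linarith [Real.rpow_pos_of_pos h0 s]) h0 h1

lemma F_pos {s : ℝ} (hs : 0 < s) {Q : ℝ} (h0 : 0 < Q) (h1 : Q < 1) : 0 < qPochInf (Q ^ s) Q :=
  qp_pos (Real.rpow_lt_one h0.le h1 hs) h0 h1

lemma rpow_interp (s t : ℝ) {Q : ℝ} (h0 : 0 < Q) :
    (Q ^ s) ^ (1 - t) * (Q ^ (s + 1)) ^ t = Q ^ (s + t) := by
  rw [← Real.rpow_mul h0.le, ← Real.rpow_mul h0.le, ← Real.rpow_add h0]; ring_nf

lemma split_rpow {x c t : ℝ} (hx : 0 < x) (hc : 0 < c) :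
    (c * x) ^ (1 - t) * x ^ t = c ^ (1 - t) * x := by
  rw [Real.mul_rpow hc.le hx.le, mul_assoc, ← Real.rpow_add hx]; simp

/-- `F(s+t) ≥ (1-Q^s)^{1-t} F(s+1)`. -/
lemma F_ge {s t : ℝ} (hs : 0 < s) (ht0 : 0 ≤ t) (ht1 : t ≤ 1) {Q : ℝ} (h0 : 0 < Q) (h1 : Q < 1) :
    (1 - Q ^ s) ^ (1 - t) * qPochInf (Q ^ (s + 1)) Q ≤ qPochInf (Q ^ (s + t)) Q := by
  have h := qp_holder_minus (Real.rpow_pos_of_pos h0 s) (Real.rpow_pos_of_pos h0 (s + 1))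
    (Real.rpow_lt_one h0.le h1 hs) (Real.rpow_lt_one h0.le h1 (by linarith)) ht0 ht1 h0 h1
  rw [rpow_interp s t h0, F_rec s h0 h1, split_rpow (F_pos (by linarith) h0 h1)
    (by linarith [Real.rpow_lt_one h0.le h1 hs])] at h
  exact h

lemma H_le (s : ℝ) {t : ℝ} (ht0 : 0 ≤ t) (ht1 : t ≤ 1) {Q : ℝ} (h0 : 0 < Q) (h1 : Q < 1) :
    qPochInf (-Q ^ (s + t)) Q ≤ (1 + Q ^ s) ^ (1 - t) * qPochInf (-Q ^ (s + 1)) Q := by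
  have h := qp_holder_plus (Real.rpow_pos_of_pos h0 s) (Real.rpow_pos_of_pos h0 (s + 1))
    ht0 ht1 h0 h1
  rw [rpow_interp s t h0, H_rec s h0 h1, split_rpow (H_pos _ h0 h1)
    (by linarith [Real.rpow_pos_of_pos h0 s])] at h
  exact h

/-- ratio limit for unit steps -/
lemma H_ratio_unit (s : ℝ) {t : ℝ} (ht0 : 0 ≤ t) (ht1 : t ≤ 1) :
    Tendsto (fun Q : ℝ => qPochInf (-Q ^ (s + t)) Q / qPochInf (-Q ^ s) Q)
      (nhdsWithin 1 (Set.Ioo 0 1)) (nhds ((2 : ℝ) ^ (-t))) := by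
  have k : ∀ r : ℝ, Tendsto (fun Q : ℝ => 1 + Q ^ r) (nhdsWithin 1 (Set.Ioo 0 1)) (nhds 2) := by
    intro r
    have := (tendsto_rpow_one r).const_add 1
    rwa [one_add_one_eq_two] at this
  have up : Tendsto (fun Q : ℝ => (1 + Q ^ s) ^ (1 - t) / (1 + Q ^ s))
      (nhdsWithin 1 (Set.Ioo 0 1)) (nhds ((2 : ℝ) ^ (-t))) := by
    have := ((k s).rpow_const (p := 1 - t) (Or.inl two_ne_zero)).div (k s) two_ne_zero
    have e : (2 : ℝ) ^ (1 - t) / 2 = 2 ^ (-t) := by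
      rw [← Real.rpow_sub_one two_ne_zero]; ring_nf
    rw [e] at this; exact this
  have lo : Tendsto (fun Q : ℝ => (1 + Q ^ (s + t)) / (1 + Q ^ (s + t)) ^ t / (1 + Q ^ s))
      (nhdsWithin 1 (Set.Ioo 0 1)) (nhds ((2 : ℝ) ^ (-t))) := by
    have := ((k (s + t)).div ((k (s + t)).rpow_const (p := t) (Or.inl two_ne_zero))
      (by positivity)).div (k s) two_ne_zero
    have e : (2 : ℝ) / 2 ^ t / 2 = 2 ^ (-t) := by
      rw [Real.rpow_neg two_pos.le]; field_simp
    rw [e] at this; exact this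
  refine tendsto_of_tendsto_of_tendsto_of_le_of_le' lo up ?_ ?_
  · filter_upwards [ev_Ioo] with Q hQ
    have h := H_le (s + t) (t := 1 - t) (by linarith) (by linarith) hQ.1 hQ.2
    have e1 : s + t + (1 - t) = s + 1 := by ring
    have e2 : 1 - (1 - t) = t := by ring
    rw [e1, e2] at h
    rw [H_rec s hQ.1 hQ.2, H_rec (s + t) hQ.1 hQ.2]
    have p1 := H_pos (s + 1) hQ.1 hQ.2
    have p2 : 0 < 1 + Q ^ s := by linarith [Real.rpow_pos_of_pos hQ.1 s]
    have p3 : 0 < 1 + Q ^ (s + t) := by linarith [Real.rpow_pos_of_pos hQ.1 (s + t)]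
    have p4 : 0 < (1 + Q ^ (s + t)) ^ t := Real.rpow_pos_of_pos p3 _
    rw [div_div, div_le_div_iff₀ (by positivity) (by positivity)]
    have := mul_le_mul_of_nonneg_left h (mul_pos p2 p3).le
    nlinarith
  · filter_upwards [ev_Ioo] with Q hQ
    have h := H_le s ht0 ht1 hQ.1 hQ.2
    rw [H_rec s hQ.1 hQ.2]
    have p1 := H_pos (s + 1) hQ.1 hQ.2
    have p2 : 0 < 1 + Q ^ s := by linarith [Real.rpow_pos_of_pos hQ.1 s]
    rw [div_le_div_iff₀ (by positivity) (by positivity)]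
    have := mul_le_mul_of_nonneg_left h p2.le
    nlinarith

lemma H_ratio_nat (s : ℝ) (N : ℕ) : ∀ {t : ℝ}, 0 ≤ t → t ≤ N + 1 →
    Tendsto (fun Q : ℝ => qPochInf (-Q ^ (s + t)) Q / qPochInf (-Q ^ s) Q)
      (nhdsWithin 1 (Set.Ioo 0 1)) (nhds ((2 : ℝ) ^ (-t))) := by
  induction N with
  | zero => intro t h h'; exact H_ratio_unit s h (by simpa using h')
  | succ N ih =>
    intro t h h'
    rcases le_total t 1 with h2 | h2
    · exact H_ratio_unit s h h2
    · have a := ih (t := t - 1) (by linarith) (by push_cast at h'; linarith)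
      have b := H_ratio_unit (s + (t - 1)) zero_le_one le_rfl
      have c := b.mul a
      rw [← Real.rpow_add two_pos] at c
      have e1 : -1 + -(t - 1) = -t := by ring
      have e2 : s + (t - 1) + 1 = s + t := by ring
      rw [e1, e2] at c
      refine c.congr' ?_
      filter_upwards [ev_Ioo] with Q hQ
      have := (H_pos (s + (t - 1)) hQ.1 hQ.2).ne'
      field_simp

lemma H_ratio (s : ℝ) {t : ℝ} (h : 0 ≤ t) :
    Tendsto (fun Q : ℝ => qPochInf (-Q ^ (s + t)) Q / qPochInf (-Q ^ s) Q)
      (nhdsWithin 1 (Set.Ioo 0 1)) (nhds ((2 : ℝ) ^ (-t))) := by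
  obtain ⟨N, hN⟩ := exists_nat_ge t
  exact H_ratio_nat s N h (by linarith)

/-- squeeze with a family of bounds -/
lemma squeeze_family {l : Filter ℝ} {g : ℝ → ℝ} {L U : ℕ → ℝ → ℝ} {a b : ℕ → ℝ} {c : ℝ}
    (hL : ∀ n, ∀ᶠ q in l, L (n + 1) q ≤ g q) (hU : ∀ n, ∀ᶠ q in l, g q ≤ U (n + 1) q)
    (ha : ∀ n, Tendsto (L (n + 1)) l (nhds (a (n + 1))))
    (hb : ∀ n, Tendsto (U (n + 1)) l (nhds (b (n + 1))))
    (hac : Tendsto a atTop (nhds c)) (hbc : Tendsto b atTop (nhds c)) :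
    Tendsto g l (nhds c) := by
  rw [tendsto_order]
  constructor
  · intro y hy
    obtain ⟨n, hn⟩ := (((tendsto_add_atTop_iff_nat 1).2 hac).eventually (lt_mem_nhds hy)).exists
    filter_upwards [hL n, (ha n).eventually (lt_mem_nhds hn)] with q h1 h2
    linarith
  · intro y hy
    obtain ⟨n, hn⟩ := (((tendsto_add_atTop_iff_nat 1).2 hbc).eventually (gt_mem_nhds hy)).exists
    filter_upwards [hU n, (hb n).eventually (gt_mem_nhds hn)] with q h1 h2
    linarith

lemma qNumber_pos {Q s : ℝ} (h0 : 0 < Q) (h1 : Q < 1) (hs : 0 < s) : 0 < qNumber Q s :=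
  div_pos (by linarith [Real.rpow_lt_one h0.le h1 hs]) (by linarith)

lemma one_sub_rpow {Q : ℝ} (s : ℝ) (h1 : Q < 1) : 1 - Q ^ s = qNumber Q s * (1 - Q) := by
  have : 1 - Q ≠ 0 := by linarith
  unfold qNumber; field_simp

lemma qGamma_pos {Q s : ℝ} (h0 : 0 < Q) (h1 : Q < 1) (hs : 0 < s) : 0 < qGammaF Q s := by
  unfold qGammaF
  have := F_pos hs h0 h1
  have h3 := qp_pos h1 h0 h1
  have h4 : 0 < (1 - Q) ^ (1 - s) := Real.rpow_pos_of_pos (by linarith) _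
  positivity

lemma qGamma_rec {Q s : ℝ} (h0 : 0 < Q) (h1 : Q < 1) (hs : 0 < s) :
    qGammaF Q (s + 1) = qNumber Q s * qGammaF Q s := by
  have hQ : 0 < 1 - Q := by linarith
  unfold qGammaF
  rw [F_rec s h0 h1, one_sub_rpow s h1]
  have p1 := (qNumber_pos h0 h1 hs).ne'
  have p2 := (F_pos (s := s + 1) (by linarith) h0 h1).ne'
  have e : (1 - Q) ^ (1 - s) = (1 - Q) ^ (1 - (s + 1)) * (1 - Q) := by
    rw [← Real.rpow_add_one hQ.ne']; ring_nf
  rw [e]; field_simp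

/-- `G(s+t) ≤ [s]^t G(s)`, in the form with `G(s+1)`. -/
lemma qGamma_le {s t : ℝ} (hs : 0 < s) (ht0 : 0 ≤ t) (ht1 : t ≤ 1) {Q : ℝ} (h0 : 0 < Q)
    (h1 : Q < 1) : qGammaF Q (s + t) ≤ qNumber Q s ^ t * qGammaF Q s := by
  have hQ : 0 < 1 - Q := by linarith
  have h := F_ge hs ht0 ht1 h0 h1
  have p1 := qNumber_pos h0 h1 hs
  have p2 := (F_pos (s := s + 1) (by linarith) h0 h1)
  have p3 := (F_pos (s := s + t) (by linarith) h0 h1)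
  have p4 := qp_pos h1 h0 h1
  have p5 : 0 < qNumber Q s ^ t := Real.rpow_pos_of_pos p1 _
  unfold qGammaF
  rw [F_rec s h0 h1]
  rw [one_sub_rpow s h1] at h ⊢
  rw [Real.mul_rpow p1.le hQ.le, Real.rpow_sub p1, Real.rpow_one] at h
  have e : (1 - Q) ^ (1 - s) = (1 - Q) ^ (1 - (s + t)) * (1 - Q) ^ t := by
    rw [← Real.rpow_add hQ]; ring_nf
  have e2 : (1 - Q) = (1 - Q) ^ (1 - t) * (1 - Q) ^ t := by
    rw [← Real.rpow_add hQ]; simp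
  have p6 : 0 < (1 - Q) ^ (1 - (s + t)) := Real.rpow_pos_of_pos hQ _
  have p7 : 0 < (1 - Q) ^ (1 - t) := Real.rpow_pos_of_pos hQ _
  have p8 : 0 < (1 - Q) ^ t := Real.rpow_pos_of_pos hQ _
  rw [e]
  generalize (1 - Q) ^ (1 - (s + t)) = u at *
  generalize (1 - Q) ^ (1 - t) = v at *
  generalize (1 - Q) ^ t = w at *
  rw [e2]
  calc qPochInf Q Q / qPochInf (Q ^ (s + t)) Q * u
      ≤ qPochInf Q Q / (qNumber Q s / qNumber Q s ^ t * v * qPochInf (Q ^ (s + 1)) Q) * u := by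
        gcongr
    _ = _ := by field_simp

lemma qGamma_ge {s t : ℝ} (hs : 0 < s) (ht0 : 0 ≤ t) (ht1 : t ≤ 1) {Q : ℝ} (h0 : 0 < Q)
    (h1 : Q < 1) :
    qNumber Q s * qGammaF Q s / qNumber Q (s + t) ^ (1 - t) ≤ qGammaF Q (s + t) := by
  have h := qGamma_le (s := s + t) (t := 1 - t) (by linarith) (by linarith) (by linarith) h0 h1
  have e : s + t + (1 - t) = s + 1 := by ring
  rw [e, qGamma_rec h0 h1 hs] at h
  rw [div_le_iff₀ (Real.rpow_pos_of_pos (qNumber_pos h0 h1 (by linarith)) _)]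
  linarith

lemma qGamma_one {Q : ℝ} (h0 : 0 < Q) (h1 : Q < 1) : qGammaF Q 1 = 1 := by
  unfold qGammaF
  have := (qp_pos h1 h0 h1).ne'
  simp [this]

lemma qGamma_shift {s : ℝ} (hs : 0 < s) {Q : ℝ} (h0 : 0 < Q) (h1 : Q < 1) (n : ℕ) :
    qGammaF Q (n + s) = (∏ j ∈ Finset.range n, qNumber Q (s + j)) * qGammaF Q s := by
  induction n with
  | zero => simp
  | succ n ih =>
    have : ((n + 1 : ℕ) : ℝ) + s = n + s + 1 := by push_cast; ring
    rw [this, qGamma_rec h0 h1 (by positivity), ih, Finset.prod_range_succ, add_comm s n]; ring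

lemma tendsto_qGamma_unit {t : ℝ} (ht0 : 0 < t) (ht1 : t ≤ 1) :
    Tendsto (fun Q => qGammaF Q t) (nhdsWithin 1 (Set.Ioo 0 1)) (nhds (Real.Gamma t)) := by
  have hpr : ∀ (s : ℝ) (n : ℕ), Tendsto (fun Q => ∏ j ∈ Finset.range n, qNumber Q (s + j))
      (nhdsWithin 1 (Set.Ioo 0 1)) (nhds (∏ j ∈ Finset.range n, (s + j))) :=
    fun s n => tendsto_finsetProd _ fun j _ => tendsto_qNumber _
  have hprpos : ∀ {Q : ℝ}, 0 < Q → Q < 1 → ∀ n : ℕ,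
      0 < ∏ j ∈ Finset.range n, qNumber Q (t + j) := fun h0 h1 n =>
    Finset.prod_pos fun j _ => qNumber_pos h0 h1 (by positivity)
  have hppos : ∀ n : ℕ, 0 < ∏ j ∈ Finset.range n, (t + (j : ℝ)) := fun n =>
    Finset.prod_pos fun j _ => (by positivity)
  have hfac : ∀ n : ℕ, (∏ j ∈ Finset.range n, ((1 : ℝ) + j)) = n.factorial := by
    intro n
    rw [← Finset.prod_range_add_one_eq_factorial]; push_cast
    exact Finset.prod_congr rfl fun _ _ => add_comm _ _
  have hdiv : Tendsto (fun n : ℕ => (n + t) / (n : ℝ)) atTop (nhds 1) := by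
    have h1 : Tendsto (fun n : ℕ => 1 + t / (n : ℝ)) atTop (nhds (1 + 0)) :=
      (tendsto_const_div_atTop_nhds_zero_nat t).const_add 1
    rw [add_zero] at h1
    refine h1.congr' ?_
    filter_upwards [eventually_gt_atTop 0] with n hn
    have : (n : ℝ) ≠ 0 := by positivity
    field_simp
  refine squeeze_family
    (L := fun n Q => qNumber Q n * (∏ j ∈ Finset.range (n - 1), qNumber Q (1 + j)) /
      qNumber Q (n + t) ^ (1 - t) / ∏ j ∈ Finset.range n, qNumber Q (t + j))
    (U := fun n Q => qNumber Q n ^ t * (∏ j ∈ Finset.range (n - 1), qNumber Q (1 + j)) /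
      ∏ j ∈ Finset.range n, qNumber Q (t + j))
    (a := fun n => (n : ℝ) * (∏ j ∈ Finset.range (n - 1), ((1 : ℝ) + j)) /
      ((n : ℝ) + t) ^ (1 - t) / ∏ j ∈ Finset.range n, (t + (j : ℝ)))
    (b := fun n => (n : ℝ) ^ t * (∏ j ∈ Finset.range (n - 1), ((1 : ℝ) + j)) /
      ∏ j ∈ Finset.range n, (t + (j : ℝ)))
    ?_ ?_ ?_ ?_ ?_ ?_
  · intro n
    filter_upwards [ev_Ioo] with Q hQ
    have h := qGamma_ge (s := ((n + 1 : ℕ) : ℝ)) (t := t) (by positivity) ht0.le ht1 hQ.1 hQ.2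
    have e := qGamma_shift one_pos hQ.1 hQ.2 n
    rw [qGamma_one hQ.1 hQ.2, mul_one] at e
    have e' : qGammaF Q ((n + 1 : ℕ) : ℝ) = ∏ j ∈ Finset.range n, qNumber Q (1 + j) := by
      rw [← e]; push_cast; rfl
    rw [qGamma_shift ht0 hQ.1 hQ.2, e'] at h
    simp only [Nat.add_sub_cancel]
    rw [div_le_iff₀ (hprpos hQ.1 hQ.2 _)]
    linarith
  · intro n
    filter_upwards [ev_Ioo] with Q hQ
    have h := qGamma_le (s := ((n + 1 : ℕ) : ℝ)) (t := t) (by positivity) ht0.le ht1 hQ.1 hQ.2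
    have e := qGamma_shift one_pos hQ.1 hQ.2 n
    rw [qGamma_one hQ.1 hQ.2, mul_one] at e
    have e' : qGammaF Q ((n + 1 : ℕ) : ℝ) = ∏ j ∈ Finset.range n, qNumber Q (1 + j) := by
      rw [← e]; push_cast; rfl
    rw [qGamma_shift ht0 hQ.1 hQ.2, e'] at h
    simp only [Nat.add_sub_cancel]
    rw [le_div_iff₀ (hprpos hQ.1 hQ.2 _)]
    linarith
  · intro n
    have q1 : ((n + 1 : ℕ) : ℝ) + t ≠ 0 := by positivity
    refine Tendsto.div (Tendsto.div ((tendsto_qNumber _).mul (hpr _ _))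
      ((tendsto_qNumber _).rpow_const (Or.inl q1)) ?_) (hpr _ _) (hppos _).ne'
    positivity
  · intro n
    have q1 : ((n + 1 : ℕ) : ℝ) ≠ 0 := by positivity
    exact Tendsto.div (((tendsto_qNumber _).rpow_const (Or.inl q1)).mul (hpr _ _)) (hpr _ _)
      (hppos _).ne'
  · have h := (Real.GammaSeq_tendsto_Gamma t).mul (hdiv.rpow_const (p := t) (Or.inl one_ne_zero))
    rw [Real.one_rpow, mul_one] at h
    refine h.congr' ?_
    filter_upwards [eventually_gt_atTop 0] with n hn
    obtain ⟨m, rfl⟩ : ∃ m, n = m + 1 := ⟨n - 1, by omega⟩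
    simp only [Real.GammaSeq, Nat.add_sub_cancel, hfac]
    rw [Finset.prod_range_succ _ (m + 1), Nat.factorial_succ]
    have q1 : 0 < ((m + 1 : ℕ) : ℝ) + t := by positivity
    have q2 : 0 < ((m + 1 : ℕ) : ℝ) := by positivity
    rw [Real.div_rpow q1.le q2.le, Real.rpow_sub q1, Real.rpow_one, add_comm t ((m + 1 : ℕ) : ℝ)]
    have := (hppos (m + 1)).ne'
    have r1 : 0 < (((m + 1 : ℕ) : ℝ) + t) ^ t := Real.rpow_pos_of_pos q1 _
    have r2 : 0 < ((m + 1 : ℕ) : ℝ) ^ t := Real.rpow_pos_of_pos q2 _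
    push_cast at *
    field_simp
  · have h := (Real.GammaSeq_tendsto_Gamma t).mul hdiv
    rw [mul_one] at h
    refine h.congr' ?_
    filter_upwards [eventually_gt_atTop 0] with n hn
    obtain ⟨m, rfl⟩ : ∃ m, n = m + 1 := ⟨n - 1, by omega⟩
    simp only [Real.GammaSeq, Nat.add_sub_cancel, hfac]
    rw [Finset.prod_range_succ _ (m + 1), Nat.factorial_succ]
    have q1 : 0 < ((m + 1 : ℕ) : ℝ) + t := by positivity
    have q2 : 0 < ((m + 1 : ℕ) : ℝ) := by positivity
    rw [add_comm t ((m + 1 : ℕ) : ℝ)]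
    have := (hppos (m + 1)).ne'
    push_cast at *
    field_simp

lemma tendsto_qGamma_nat (N : ℕ) : ∀ {t : ℝ}, 0 < t → t ≤ N + 1 →
    Tendsto (fun Q => qGammaF Q t) (nhdsWithin 1 (Set.Ioo 0 1)) (nhds (Real.Gamma t)) := by
  induction N with
  | zero => intro t h h'; exact tendsto_qGamma_unit h (by simpa using h')
  | succ N ih =>
    intro t h h'
    rcases le_or_gt t 1 with h2 | h2
    · exact tendsto_qGamma_unit h h2
    · have a := ih (t := t - 1) (by linarith) (by push_cast at h'; linarith)
      have c := (tendsto_qNumber (t - 1)).mul a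
      rw [← Real.Gamma_add_one (by linarith), sub_add_cancel] at c
      refine c.congr' ?_
      filter_upwards [ev_Ioo] with Q hQ
      rw [← qGamma_rec hQ.1 hQ.2 (by linarith), sub_add_cancel]

lemma tendsto_qGamma {t : ℝ} (h : 0 < t) :
    Tendsto (fun Q => qGammaF Q t) (nhdsWithin 1 (Set.Ioo 0 1)) (nhds (Real.Gamma t)) := by
  obtain ⟨N, hN⟩ := exists_nat_ge t
  exact tendsto_qGamma_nat N h (by linarith)

/-- limit of the normalization constant -/
lemma tendsto_cAlpha {α : ℝ} (hα : -1 < α) :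
    Tendsto (fun q : ℝ => (1 - q ^ 2) ^ ((α + 1) / 2) * cAlpha q α)
      (nhdsWithin 1 (Set.Ioo 0 1)) (nhds (Real.sqrt (1 / Real.Gamma (α + 1)))) := by
  have hg : 0 < α + 1 := by linarith
  have a := (H_ratio (1 / 2 - (α + 1)) hg.le).comp tendsto_sq_within
  have b := (H_ratio (1 / 2) hg.le).comp tendsto_sq_within
  have c := (tendsto_qGamma hg).comp tendsto_sq_within
  have d : Tendsto (fun q : ℝ => (1 + q) / 2) (nhdsWithin 1 (Set.Ioo 0 1)) (nhds 1) := by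
    have := (tendsto_id_one.const_add 1).div_const 2
    norm_num only at this; simpa using this
  have e := (((b.div a (by positivity)).mul d).div c (Real.Gamma_pos_of_pos hg).ne').sqrt
  rw [div_self (by positivity), one_mul] at e
  refine e.congr' ?_
  filter_upwards [ev_Ioo] with q ⟨h0, h1⟩
  have hQ0 : 0 < q ^ 2 := by positivity
  have hQ1 : q ^ 2 < 1 := pow_lt_one₀ h0.le h1 two_ne_zero
  have hQ : 0 < 1 - q ^ 2 := by linarith
  have key : ∀ r : ℝ, q ^ (2 * r) = (q ^ 2) ^ r := fun r => by
    rw [Real.rpow_mul h0.le]; norm_num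
  have k1 : q ^ (-(2 * α + 1)) = (q ^ 2) ^ (1 / 2 - (α + 1)) := by rw [← key]; ring_nf
  have k2 : q ^ (2 * α + 3) = (q ^ 2) ^ (1 / 2 + (α + 1)) := by rw [← key]; ring_nf
  have k3 : q ^ (2 * α + 2) = (q ^ 2) ^ (α + 1) := by rw [← key]; ring_nf
  have k4 : qPochInf (-q) (q ^ 2) = qPochInf (-(q ^ 2) ^ ((1 : ℝ) / 2)) (q ^ 2) := by
    rw [← key]; norm_num
  unfold cAlpha
  rw [k1, k2, k3, k4]
  have k5 : (1 - q ^ 2) ^ ((α + 1) / 2) = Real.sqrt ((1 - q ^ 2) ^ (α + 1)) := by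
    rw [Real.sqrt_eq_rpow, ← Real.rpow_mul hQ.le]; ring_nf
  rw [k5, ← Real.sqrt_mul (Real.rpow_nonneg hQ.le _)]
  congr 1
  have s1 : 1 / 2 - (α + 1) + (α + 1) = (1 : ℝ) / 2 := by ring
  simp only [Pi.div_apply, Function.comp, s1, qGammaF]
  have k6 : (1 - q ^ 2) ^ (1 - (α + 1)) * (1 - q ^ 2) ^ (α + 1) = (1 - q) * (1 + q) := by
    rw [← Real.rpow_add hQ]; simp; ring
  have p1 := (H_pos (1 / 2) hQ0 hQ1).ne'
  have p2 := (H_pos (1 / 2 - (α + 1)) hQ0 hQ1).ne'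
  have p3 := (F_pos hg hQ0 hQ1).ne'
  have p4 := (qp_pos hQ1 hQ0 hQ1).ne'
  have p5 := (Real.rpow_pos_of_pos hQ (α + 1)).ne'
  have p6 := (Real.rpow_pos_of_pos hQ (1 - (α + 1))).ne'
  have p7 : 1 - q ≠ 0 := by linarith
  generalize (1 - q ^ 2) ^ (1 - (α + 1)) = u at *
  generalize (1 - q ^ 2) ^ (α + 1) = v at *
  generalize qPochInf (-(q ^ 2) ^ (1 / 2 - (α + 1))) (q ^ 2) = H1 at *
  generalize qPochInf (-(q ^ 2) ^ (1 / 2 + (α + 1))) (q ^ 2) = H2 at *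
  generalize qPochInf (-(q ^ 2) ^ ((1 : ℝ) / 2)) (q ^ 2) = H3 at *
  generalize qPochInf ((q ^ 2) ^ (α + 1)) (q ^ 2) = F1 at *
  generalize qPochInf (q ^ 2) (q ^ 2) = F2 at *
  have k7 : 1 + q = u * v / (1 - q) := by rw [k6]; field_simp
  rw [k7]
  field_simp

lemma omega_eq (q α x : ℝ) :
    omegaAlpha q α x = (qPochInf (-(q ^ (-(2 * α + 1)) * x ^ 2)) (q ^ 2))⁻¹ := by
  unfold omegaAlpha qPochInf
  congr 2; funext k; rw [pow_mul]; ring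

lemma qp_exp_bounds {z Q : ℝ} (hz : 0 ≤ z) (h0 : 0 < Q) (h1 : Q < 1) :
    Real.exp (z / (1 + z * (1 - Q))) ≤ qPochInf (-(z * (1 - Q))) Q ∧
      qPochInf (-(z * (1 - Q))) Q ≤ Real.exp z := by
  have hQ : 0 < 1 - Q := by linarith
  have hs := summable_geometric_of_lt_one h0.le h1
  have hneg : -(z * (1 - Q)) < 1 := by nlinarith [mul_nonneg hz hQ.le]
  have hlog : Summable fun k : ℕ => Real.log (1 - -(z * (1 - Q)) * Q ^ k) := by
    simpa [sub_eq_add_neg] using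
      Real.summable_log_one_add_of_summable (qp_summable (-(z * (1 - Q))) h0 h1)
  rw [← qp_exp hneg h0 h1, Real.exp_le_exp, Real.exp_le_exp]
  have hp : 0 < 1 + z * (1 - Q) := by positivity
  constructor
  · have e : z / (1 + z * (1 - Q)) = ∑' k : ℕ, z * (1 - Q) / (1 + z * (1 - Q)) * Q ^ k := by
      rw [tsum_mul_left, tsum_geometric_of_lt_one h0.le h1]; field_simp
    rw [e]
    refine (hs.mul_left _).tsum_le_tsum (fun k => ?_) hlog
    have hk : Q ^ k ≤ 1 := pow_le_one₀ h0.le h1.le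
    have hk0 : 0 < Q ^ k := pow_pos h0 k
    have hf := qp_factor_pos hneg h0 h1 k
    refine le_trans ?_ (Real.one_sub_inv_le_log_of_pos hf)
    have e2 : 1 - (1 - -(z * (1 - Q)) * Q ^ k)⁻¹ =
        z * (1 - Q) * Q ^ k / (1 - -(z * (1 - Q)) * Q ^ k) := by
      rw [eq_div_iff hf.ne', sub_mul, inv_mul_cancel₀ hf.ne']; ring
    rw [e2, div_mul_eq_mul_div]
    have : 0 ≤ z * (1 - Q) := by positivity
    gcongr
    nlinarith
  · have e : z = ∑' k : ℕ, z * (1 - Q) * Q ^ k := by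
      rw [tsum_mul_left, tsum_geometric_of_lt_one h0.le h1]; field_simp
    conv_rhs => rw [e]
    refine hlog.tsum_le_tsum (fun k => ?_) (hs.mul_left _)
    have hf := qp_factor_pos hneg h0 h1 k
    refine (Real.log_le_sub_one_of_pos hf).trans (le_of_eq (by ring))

lemma tendsto_omega (α x : ℝ) :
    Tendsto (fun q : ℝ => Real.sqrt (omegaAlpha q α (Real.sqrt (1 - q ^ 2) * x)))
      (nhdsWithin 1 (Set.Ioo 0 1)) (nhds (Real.exp (-x ^ 2 / 2))) := by
  have hz : Tendsto (fun q : ℝ => q ^ (-(2 * α + 1)) * x ^ 2) (nhdsWithin 1 (Set.Ioo 0 1))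
      (nhds (x ^ 2)) := by simpa using (tendsto_rpow_one (-(2 * α + 1))).mul_const (x ^ 2)
  have hq2 : Tendsto (fun q : ℝ => 1 - q ^ 2) (nhdsWithin 1 (Set.Ioo 0 1)) (nhds 0) := by
    have := (tendsto_id_one.pow 2).const_sub 1
    rwa [one_pow, sub_self] at this
  have hlo : Tendsto (fun q : ℝ => Real.exp (q ^ (-(2 * α + 1)) * x ^ 2 /
      (1 + q ^ (-(2 * α + 1)) * x ^ 2 * (1 - q ^ 2)))) (nhdsWithin 1 (Set.Ioo 0 1))
      (nhds (Real.exp (x ^ 2))) := by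
    have h := hz.div ((hz.mul hq2).const_add 1) (by simp)
    rw [mul_zero, add_zero, div_one] at h
    exact (Real.continuous_exp.tendsto _).comp h
  have hhi := (Real.continuous_exp.tendsto _).comp hz
  have hm : Tendsto (fun q : ℝ => qPochInf (-(q ^ (-(2 * α + 1)) * x ^ 2 * (1 - q ^ 2))) (q ^ 2))
      (nhdsWithin 1 (Set.Ioo 0 1)) (nhds (Real.exp (x ^ 2))) := by
    refine tendsto_of_tendsto_of_tendsto_of_le_of_le' hlo hhi ?_ ?_ <;>
    · filter_upwards [ev_Ioo] with q hq
      have := Real.rpow_pos_of_pos hq.1 (-(2 * α + 1))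
      have h := qp_exp_bounds (z := q ^ (-(2 * α + 1)) * x ^ 2) (by positivity)
        (pow_pos hq.1 2) (pow_lt_one₀ hq.1.le hq.2 two_ne_zero)
      first | exact h.1 | exact h.2
  have h := (hm.inv₀ (Real.exp_ne_zero _)).sqrt
  have e : Real.sqrt (Real.exp (x ^ 2))⁻¹ = Real.exp (-x ^ 2 / 2) := by
    rw [← Real.exp_neg, Real.exp_half]
  rw [e] at h
  refine h.congr' ?_
  filter_upwards [ev_Ioo] with q hq
  have hQ1 : q ^ 2 < 1 := pow_lt_one₀ hq.1.le hq.2 two_ne_zero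
  rw [omega_eq, mul_pow, Real.sq_sqrt (by linarith)]
  congr 4; ring

lemma gammaGen_zero {ν : ℝ} (hν : 0 < ν + 1 / 2) : gammaGen ν 0 = 1 := by
  have := (Real.Gamma_pos_of_pos hν).ne'
  simp only [gammaGen]; norm_num
  norm_num at this; exact this

lemma gammaGen_succ {ν : ℝ} (hν : 0 < ν + 1 / 2) (n : ℕ) :
    gammaGen ν (n + 1) =
      (if (n + 1) % 2 = 0 then ((n + 1 : ℕ) : ℝ) else ((n + 1 : ℕ) : ℝ) + 2 * ν) * gammaGen ν n := by
  have hg := (Real.Gamma_pos_of_pos hν).ne'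
  rcases Nat.even_or_odd' n with ⟨k, rfl | rfl⟩
  · have e1 : (2 * k + 1) % 2 ≠ 0 := by omega
    have e2 : (2 * k + 1) / 2 = k := by omega
    have e3 : (2 * k + 1 + 1) / 2 = k + 1 := by omega
    have e4 : (2 * k) / 2 = k := by omega
    rw [if_neg e1]
    simp only [gammaGen, e2, e3, e4]
    have : ν + ((k + 1 : ℕ) : ℝ) + 1 / 2 = (ν + k + 1 / 2) + 1 := by push_cast; ring
    rw [this, Real.Gamma_add_one (by have : (0 : ℝ) ≤ k := by positivity
                                     linarith)]
    push_cast; field_simp; ring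
  · have e1 : (2 * k + 1 + 1) % 2 = 0 := by omega
    have e2 : (2 * k + 1 + 1) / 2 = k + 1 := by omega
    have e3 : (2 * k + 1 + 1 + 1) / 2 = k + 1 := by omega
    have e4 : (2 * k + 1) / 2 = k := by omega
    rw [if_pos e1]
    simp only [gammaGen, e2, e3, e4, Nat.factorial_succ]
    push_cast; field_simp; ring

lemma gammaGen_pos {ν : ℝ} (hν : 0 < ν + 1 / 2) (n : ℕ) : 0 < gammaGen ν n := by
  have h1 := Real.Gamma_pos_of_pos hν
  have h2 : 0 < Real.Gamma (ν + (((n + 1) / 2 : ℕ) : ℝ) + 1 / 2) :=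
    Real.Gamma_pos_of_pos (by
      have : (0 : ℝ) ≤ (((n + 1) / 2 : ℕ) : ℝ) := by positivity
      linarith)
  have h3 : (0 : ℝ) < (n / 2).factorial := by exact_mod_cast Nat.factorial_pos _
  unfold gammaGen; positivity

lemma tendsto_qFact {α : ℝ} (hα : -1 < α) (n : ℕ) :
    Tendsto (fun q => qFactAlpha q α n) (nhdsWithin 1 (Set.Ioo 0 1))
      (nhds (gammaGen (α + 1 / 2) n)) := by
  have hν : 0 < α + 1 / 2 + 1 / 2 := by linarith
  induction n with
  | zero => simp only [qFactAlpha, Finset.prod_range_zero, gammaGen_zero hν]; exact tendsto_const_nhds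
  | succ n ih =>
    simp only [qFactAlpha, Finset.prod_range_succ] at ih ⊢
    rw [gammaGen_succ hν, mul_comm]
    refine ih.mul ?_
    unfold qNumAlpha
    split_ifs
    · exact tendsto_qNumber _
    · convert tendsto_qNumber _ using 2; ring

lemma qFact_pos {q α : ℝ} (h0 : 0 < q) (h1 : q < 1) (hα : -1 < α) (n : ℕ) :
    0 < qFactAlpha q α n := by
  refine Finset.prod_pos fun k _ => ?_
  unfold qNumAlpha
  have hk : (0 : ℝ) ≤ k := by positivity
  split_ifs
  · exact qNumber_pos h0 h1 (by positivity)
  · exact qNumber_pos h0 h1 (by push_cast; linarith)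

/-- `k!_{q²}` -/
def nFac (q : ℝ) (k : ℕ) : ℝ := ∏ j ∈ Finset.range k, qNumber (q ^ 2) (1 + j)

lemma nFac_pos {q : ℝ} (h0 : 0 < q) (h1 : q < 1) (k : ℕ) : 0 < nFac q k :=
  Finset.prod_pos fun j _ => qNumber_pos (pow_pos h0 2) (pow_lt_one₀ h0.le h1 two_ne_zero)
    (by positivity)

lemma tendsto_nFac (k : ℕ) :
    Tendsto (fun q => nFac q k) (nhdsWithin 1 (Set.Ioo 0 1)) (nhds (k.factorial : ℝ)) := by
  have : (k.factorial : ℝ) = ∏ j ∈ Finset.range k, ((1 : ℝ) + j) := by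
    rw [← Finset.prod_range_add_one_eq_factorial]; push_cast
    exact Finset.prod_congr rfl fun _ _ => add_comm _ _
  rw [this]
  exact tendsto_finsetProd _ fun j _ => (tendsto_qNumber _).comp tendsto_sq_within

lemma qPoch_sq {q : ℝ} (h0 : 0 < q) (h1 : q < 1) (k : ℕ) :
    qPoch (q ^ 2) (q ^ 2) k = (1 - q ^ 2) ^ k * nFac q k := by
  have hQ1 : q ^ 2 < 1 := pow_lt_one₀ h0.le h1 two_ne_zero
  unfold qPoch nFac
  rw [← Finset.card_range k, ← Finset.prod_const, Finset.card_range, ← Finset.prod_mul_distrib]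
  refine Finset.prod_congr rfl fun j _ => ?_
  rw [mul_comm (1 - q ^ 2), ← one_sub_rpow _ hQ1, Real.rpow_add (pow_pos h0 2), Real.rpow_one,
    Real.rpow_natCast]

lemma qPoch_pos {q : ℝ} (h0 : 0 < q) (h1 : q < 1) (n : ℕ) : 0 < qPoch q q n :=
  Finset.prod_pos fun k _ => qp_factor_pos h1 h0 h1 k

/-- rescaled coefficients -/
def aCoef (q α : ℝ) (n k : ℕ) : ℝ :=
  (-1 : ℝ) ^ k * q ^ ((k * (2 * k + 1) : ℤ) - (2 * n * k : ℤ)) * Real.sqrt (1 + q) ^ (n - 2 * k) /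
    (Real.sqrt (1 + q) ^ (2 * k) * nFac q k * qFactAlpha q α (n - 2 * k))

lemma hTilde_scaled {q α : ℝ} (h0 : 0 < q) (h1 : q < 1) (hα : -1 < α) (n : ℕ) (x : ℝ) :
    Real.sqrt (qPochAlpha q α n) / qPoch q q n * hTilde q α n (Real.sqrt (1 - q ^ 2) * x) =
      Real.sqrt (qFactAlpha q α n) *
        ∑ k ∈ Finset.range (n / 2 + 1), aCoef q α n k * x ^ (n - 2 * k) := by
  have hu : 0 < Real.sqrt (1 - q) := Real.sqrt_pos.2 (by linarith)
  have hv : 0 < Real.sqrt (1 + q) := Real.sqrt_pos.2 (by linarith)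
  have hu2 : Real.sqrt (1 - q) ^ 2 = 1 - q := Real.sq_sqrt (by linarith)
  have hv2 : Real.sqrt (1 + q) ^ 2 = 1 + q := Real.sq_sqrt (by linarith)
  have huv : Real.sqrt (1 - q ^ 2) = Real.sqrt (1 - q) * Real.sqrt (1 + q) := by
    rw [← Real.sqrt_mul (by linarith)]; ring_nf
  have hpoch := (qPoch_pos h0 h1 n).ne'
  have hs : Real.sqrt (qPochAlpha q α n) =
      Real.sqrt (1 - q) ^ n * Real.sqrt (qFactAlpha q α n) := by
    unfold qPochAlpha
    rw [Real.sqrt_mul (pow_nonneg (by linarith) _)]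
    congr 1
    rw [← hu2, ← pow_mul, mul_comm 2 n, pow_mul, Real.sqrt_sq (by positivity), hu2]
  unfold hTilde
  rw [hs, ← mul_assoc, div_mul_cancel₀ _ hpoch, mul_comm (Real.sqrt (1 - q) ^ n), mul_assoc]
  congr 1
  rw [Finset.mul_sum]
  refine Finset.sum_congr rfl fun k hk => ?_
  have hk2 : 2 * k ≤ n := by have := Finset.mem_range.1 hk; omega
  obtain ⟨m, rfl⟩ := Nat.exists_eq_add_of_le hk2
  have em : 2 * k + m - 2 * k = m := by omega
  unfold aCoef
  rw [em, qPoch_sq h0 h1, huv]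
  unfold qPochAlpha
  have e2 : 1 - q ^ 2 = (Real.sqrt (1 - q) * Real.sqrt (1 + q)) ^ 2 := by
    rw [mul_pow, hu2, hv2]; ring
  have p1 := (nFac_pos h0 h1 k).ne'
  have p2 := (qFact_pos h0 h1 hα m).ne'
  have e3 : (1 - q) ^ m = Real.sqrt (1 - q) ^ m * Real.sqrt (1 - q) ^ m := by
    rw [← mul_pow, ← sq, hu2]
  rw [e2, e3, mul_pow, mul_pow, ← pow_mul, mul_pow, pow_add]
  generalize q ^ (((k : ℤ) * (2 * k + 1)) - 2 * ((2 * k + m : ℕ) : ℤ) * k) = z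
  generalize Real.sqrt (1 - q) = u at *
  generalize Real.sqrt (1 + q) = v at *
  field_simp

lemma tendsto_aCoef {α : ℝ} (hα : -1 < α) (n k : ℕ) :
    Tendsto (fun q => aCoef q α n k) (nhdsWithin 1 (Set.Ioo 0 1))
      (nhds ((-1 : ℝ) ^ k * Real.sqrt 2 ^ (n - 2 * k) /
        (Real.sqrt 2 ^ (2 * k) * k.factorial * gammaGen (α + 1 / 2) (n - 2 * k)))) := by
  have hv : Tendsto (fun q : ℝ => Real.sqrt (1 + q)) (nhdsWithin 1 (Set.Ioo 0 1))
      (nhds (Real.sqrt 2)) := by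
    have := (tendsto_id_one.const_add 1).sqrt
    rwa [one_add_one_eq_two] at this
  have hz : Tendsto (fun q : ℝ => q ^ ((k * (2 * k + 1) : ℤ) - (2 * n * k : ℤ)))
      (nhdsWithin 1 (Set.Ioo 0 1)) (nhds 1) := by
    simpa using tendsto_id_one.zpow₀ ((k * (2 * k + 1) : ℤ) - (2 * n * k : ℤ)) (Or.inl one_ne_zero)
  have hg := gammaGen_pos (ν := α + 1 / 2) (by linarith) (n - 2 * k)
  have hf : (0 : ℝ) < k.factorial := by exact_mod_cast Nat.factorial_pos _
  have h := ((hz.const_mul ((-1 : ℝ) ^ k)).mul (hv.pow (n - 2 * k))).div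
    (((hv.pow (2 * k)).mul (tendsto_nFac k)).mul (tendsto_qFact hα (n - 2 * k))) (by positivity)
  rw [mul_one] at h
  exact h

lemma theta_cases (n : ℕ) : (theta n = 0 ∧ (-1 : ℝ) ^ n = 1) ∨ (theta n = 1 ∧ (-1 : ℝ) ^ n = -1) := by
  rcases Nat.even_or_odd n with h | h
  · left; exact ⟨by simp [theta, Nat.even_iff.1 h], h.neg_one_pow⟩
  · right; exact ⟨by simp [theta, Nat.odd_iff.1 h], h.neg_one_pow⟩

/-- the bracket factor -/
def bCoef (q α x : ℝ) (n m : ℕ) : ℝ :=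
  ((1 + q ^ (-(2 * α + 1)) * (1 - q ^ 2) * x ^ 2) * q ^ m - q ^ (-((2 * α + 1) * theta n))) / (1 - q)

lemma tendsto_bCoef (α x : ℝ) (n m : ℕ) :
    Tendsto (fun q => bCoef q α x n m) (nhdsWithin 1 (Set.Ioo 0 1))
      (nhds (2 * x ^ 2 - m - (2 * α + 1) * theta n)) := by
  have h1 := tendsto_qNumber (m : ℝ)
  have h2 := tendsto_qNumber (-((2 * α + 1) * theta n))
  have h3 : Tendsto (fun q : ℝ => q ^ (-(2 * α + 1)) * (1 + q) * x ^ 2 * q ^ m)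
      (nhdsWithin 1 (Set.Ioo 0 1)) (nhds (1 * (1 + 1) * x ^ 2 * 1 ^ m)) :=
    (((tendsto_rpow_one _).mul (tendsto_id_one.const_add 1)).mul_const _).mul (tendsto_id_one.pow m)
  have h := (h3.sub h1).add h2
  have e : 1 * (1 + 1) * x ^ 2 * 1 ^ m - (m : ℝ) + -((2 * α + 1) * theta n) =
      2 * x ^ 2 - m - (2 * α + 1) * theta n := by rw [one_pow]; ring
  rw [e] at h
  refine h.congr' ?_
  filter_upwards [ev_Ioo] with q hq
  have : 1 - q ≠ 0 := by linarith [hq.2]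
  unfold bCoef qNumber
  rw [Real.rpow_natCast]
  field_simp
  ring

lemma lhs_eq {q α : ℝ} (h0 : 0 < q) (h1 : q < 1) (hα : -1 < α) (n : ℕ) {x : ℝ} (hx : x ≠ 0) :
    (1 - q ^ 2) ^ ((α + 1) / 2) *
          (q ^ (2 * α + 3 / 2) / (Real.sqrt (1 - q) * Real.sqrt (1 - q ^ 2) * x)) *
          (Real.sqrt (1 + q ^ (-(2 * α + 1)) * (1 - q ^ 2) * x ^ 2) *
              phiQ q α n (q * (Real.sqrt (1 - q ^ 2) * x)) -
            q ^ (-((2 * α + 1) * theta n)) * phiQ q α n (Real.sqrt (1 - q ^ 2) * x)) =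
    ((1 - q ^ 2) ^ ((α + 1) / 2) * cAlpha q α) * q ^ (2 * α + 3 / 2) * q ^ (((n : ℝ) ^ 2) / 2) *
      Real.sqrt (omegaAlpha q α (Real.sqrt (1 - q ^ 2) * x)) * Real.sqrt (qFactAlpha q α n) *
      (∑ k ∈ Finset.range (n / 2 + 1), aCoef q α n k * x ^ (n - 2 * k) * bCoef q α x n (n - 2 * k)) /
      (Real.sqrt (1 + q) * x) := by
  have hQ0 : 0 < q ^ 2 := pow_pos h0 2
  have hQ1 : q ^ 2 < 1 := pow_lt_one₀ h0.le h1 two_ne_zero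
  have hu : 0 < Real.sqrt (1 - q) := Real.sqrt_pos.2 (by linarith)
  have hv : 0 < Real.sqrt (1 + q) := Real.sqrt_pos.2 (by linarith)
  have hu2 : Real.sqrt (1 - q) ^ 2 = 1 - q := Real.sq_sqrt (by linarith)
  have huv : Real.sqrt (1 - q ^ 2) = Real.sqrt (1 - q) * Real.sqrt (1 + q) := by
    rw [← Real.sqrt_mul (by linarith)]; ring_nf
  have hr := Real.rpow_pos_of_pos h0 (-(2 * α + 1))
  have hw : 0 < 1 + q ^ (-(2 * α + 1)) * (1 - q ^ 2) * x ^ 2 := by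
    have : 0 < 1 - q ^ 2 := by linarith
    positivity
  set W := 1 + q ^ (-(2 * α + 1)) * (1 - q ^ 2) * x ^ 2 with hW
  have hom : Real.sqrt W * Real.sqrt (omegaAlpha q α (q * (Real.sqrt (1 - q ^ 2) * x))) =
      W * Real.sqrt (omegaAlpha q α (Real.sqrt (1 - q ^ 2) * x)) := by
    have hsq : (Real.sqrt (1 - q ^ 2) * x) ^ 2 = (1 - q ^ 2) * x ^ 2 := by
      rw [mul_pow, Real.sq_sqrt (by linarith)]
    have e1 : omegaAlpha q α (q * (Real.sqrt (1 - q ^ 2) * x)) =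
        W * omegaAlpha q α (Real.sqrt (1 - q ^ 2) * x) := by
      rw [omega_eq, omega_eq, qp_rec (-(q ^ (-(2 * α + 1)) * (Real.sqrt (1 - q ^ 2) * x) ^ 2))
        hQ0 hQ1, mul_pow q, hsq]
      have e2 : 1 - -(q ^ (-(2 * α + 1)) * ((1 - q ^ 2) * x ^ 2)) = W := by rw [hW]; ring
      have e3 : -(q ^ (-(2 * α + 1)) * ((1 - q ^ 2) * x ^ 2)) * q ^ 2 =
          -(q ^ (-(2 * α + 1)) * (q ^ 2 * ((1 - q ^ 2) * x ^ 2))) := by ring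
      rw [e2, e3, mul_inv, mul_inv_cancel_left₀ hw.ne']
    rw [e1, Real.sqrt_mul hw.le, ← mul_assoc, Real.mul_self_sqrt hw.le]
  have s1 := hTilde_scaled h0 h1 hα n x
  have s2 := hTilde_scaled h0 h1 hα n (q * x)
  have e4 : Real.sqrt (1 - q ^ 2) * (q * x) = q * (Real.sqrt (1 - q ^ 2) * x) := by ring
  rw [e4] at s2
  have hsum : (∑ k ∈ Finset.range (n / 2 + 1),
        aCoef q α n k * x ^ (n - 2 * k) * bCoef q α x n (n - 2 * k)) * (1 - q) =
      W * (∑ k ∈ Finset.range (n / 2 + 1), aCoef q α n k * (q * x) ^ (n - 2 * k)) -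
      q ^ (-((2 * α + 1) * theta n)) *
        (∑ k ∈ Finset.range (n / 2 + 1), aCoef q α n k * x ^ (n - 2 * k)) := by
    rw [Finset.sum_mul, Finset.mul_sum, Finset.mul_sum, ← Finset.sum_sub_distrib]
    refine Finset.sum_congr rfl fun k _ => ?_
    unfold bCoef
    have : 1 - q ≠ 0 := by linarith
    rw [← hW, mul_pow]; field_simp
  unfold phiQ dAlpha
  set S1 := ∑ k ∈ Finset.range (n / 2 + 1), aCoef q α n k * x ^ (n - 2 * k)
  set S2 := ∑ k ∈ Finset.range (n / 2 + 1), aCoef q α n k * (q * x) ^ (n - 2 * k)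
  set S3 := ∑ k ∈ Finset.range (n / 2 + 1),
        aCoef q α n k * x ^ (n - 2 * k) * bCoef q α x n (n - 2 * k)
  set θq := q ^ (-((2 * α + 1) * theta n))
  set y := Real.sqrt (1 - q ^ 2) * x
  have hbr : Real.sqrt W * (cAlpha q α * q ^ ((n : ℝ) ^ 2 / 2) * Real.sqrt (qPochAlpha q α n) /
        qPoch q q n * Real.sqrt (omegaAlpha q α (q * y)) * hTilde q α n (q * y)) -
      θq * (cAlpha q α * q ^ ((n : ℝ) ^ 2 / 2) * Real.sqrt (qPochAlpha q α n) / qPoch q q n *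
        Real.sqrt (omegaAlpha q α y) * hTilde q α n y) =
      cAlpha q α * q ^ ((n : ℝ) ^ 2 / 2) * Real.sqrt (omegaAlpha q α y) *
        Real.sqrt (qFactAlpha q α n) * (S3 * (1 - q)) := by
    calc _ = cAlpha q α * q ^ ((n : ℝ) ^ 2 / 2) *
          (Real.sqrt W * Real.sqrt (omegaAlpha q α (q * y))) *
          (Real.sqrt (qPochAlpha q α n) / qPoch q q n * hTilde q α n (q * y)) -
        θq * (cAlpha q α * q ^ ((n : ℝ) ^ 2 / 2) * Real.sqrt (omegaAlpha q α y) *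
          (Real.sqrt (qPochAlpha q α n) / qPoch q q n * hTilde q α n y)) := by ring
      _ = _ := by rw [hom, s1, s2, hsum]; ring
  rw [hbr, huv]
  generalize Real.sqrt (1 - q) = u at *
  rw [← hu2]
  field_simp

lemma rhs_eq {α : ℝ} (hα : -1 < α) (n : ℕ) {x : ℝ} (hx : x ≠ 0) :
    1 / Real.sqrt 2 *
        (-deriv (phiGen (α + 1 / 2) n) x -
          (α + 1 / 2) / x * (phiGen (α + 1 / 2) n x - phiGen (α + 1 / 2) n (-x)) +
          x * phiGen (α + 1 / 2) n x) =
    Real.sqrt (1 / Real.Gamma (α + 1)) * 1 * 1 * Real.exp (-x ^ 2 / 2) *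
      Real.sqrt (gammaGen (α + 1 / 2) n) *
      (∑ k ∈ Finset.range (n / 2 + 1), ((-1 : ℝ) ^ k * Real.sqrt 2 ^ (n - 2 * k) /
        (Real.sqrt 2 ^ (2 * k) * k.factorial * gammaGen (α + 1 / 2) (n - 2 * k))) *
          x ^ (n - 2 * k) * (2 * x ^ 2 - ((n - 2 * k : ℕ) : ℝ) - (2 * α + 1) * theta n)) /
      (Real.sqrt 2 * x) := by
  set ν := α + 1 / 2 with hν
  have hν1 : ν + 1 / 2 = α + 1 := by rw [hν]; ring
  have hν0 : 0 < ν + 1 / 2 := by linarith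
  have hG := Real.Gamma_pos_of_pos hν0
  have h2 : 0 < Real.sqrt 2 := Real.sqrt_pos.2 two_pos
  have h22 : Real.sqrt 2 ^ 2 = 2 := Real.sq_sqrt two_pos.le
  have hnf : (n.factorial : ℝ) ≠ 0 := by exact_mod_cast (Nat.factorial_pos n).ne'
  have hpow : (2 : ℝ) ^ ((n : ℝ) / 2) = Real.sqrt 2 ^ n := by
    rw [Real.sqrt_eq_rpow, ← Real.rpow_natCast, ← Real.rpow_mul two_pos.le]; ring_nf
  set C := Real.sqrt (gammaGen ν n / Real.Gamma (ν + 1 / 2)) / Real.sqrt 2 ^ n with hC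
  let S : ℝ → ℝ := fun y => ∑ k ∈ Finset.range (n / 2 + 1),
    (-1 : ℝ) ^ k * (2 * y) ^ (n - 2 * k) / ((Nat.factorial k : ℝ) * gammaGen ν (n - 2 * k))
  have hphi : ∀ y, phiGen ν n y = C * (Real.exp (-y ^ 2 / 2) * S y) := by
    intro y
    simp only [phiGen, HGen, hpow, hC, S]
    field_simp
  let S' : ℝ := ∑ k ∈ Finset.range (n / 2 + 1),
    (-1 : ℝ) ^ k * (((n - 2 * k : ℕ) : ℝ) * (2 * x) ^ (n - 2 * k - 1) * (2 * 1)) /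
      ((Nat.factorial k : ℝ) * gammaGen ν (n - 2 * k))
  have hS : HasDerivAt S S' x := by
    refine HasDerivAt.fun_sum fun k _ => ?_
    exact ((((hasDerivAt_id x).const_mul 2).pow _).const_mul _).div_const _
  have hxS : x * S' = ∑ k ∈ Finset.range (n / 2 + 1), ((n - 2 * k : ℕ) : ℝ) *
      ((-1 : ℝ) ^ k * (2 * x) ^ (n - 2 * k) / ((Nat.factorial k : ℝ) * gammaGen ν (n - 2 * k))) := by
    simp only [S', Finset.mul_sum]
    refine Finset.sum_congr rfl fun k _ => ?_
    rcases Nat.eq_zero_or_pos (n - 2 * k) with h | h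
    · simp [h]
    · obtain ⟨m, hm⟩ : ∃ m, n - 2 * k = m + 1 := ⟨n - 2 * k - 1, by omega⟩
      rw [hm, Nat.add_sub_cancel, pow_succ (2 * x)]; ring
  have hE : HasDerivAt (fun y : ℝ => Real.exp (-y ^ 2 / 2)) (Real.exp (-x ^ 2 / 2) * (-x)) x := by
    have h := (((hasDerivAt_id x).pow 2).neg.div_const 2).exp
    have e : Real.exp ((-id ^ 2 : ℝ → ℝ) x / 2) * (-(((2 : ℕ) : ℝ) * id x ^ (2 - 1) * 1) / 2) =
        Real.exp (-x ^ 2 / 2) * (-x) := by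
      simp; ring
    rw [e] at h
    exact h
  have hder : deriv (phiGen ν n) x =
      C * (Real.exp (-x ^ 2 / 2) * (-x) * S x + Real.exp (-x ^ 2 / 2) * S') := by
    have : phiGen ν n = fun y => C * (Real.exp (-y ^ 2 / 2) * S y) := funext hphi
    rw [this]
    exact ((hE.mul hS).const_mul C).deriv
  have hSneg : S (-x) = (-1 : ℝ) ^ n * S x := by
    simp only [S, Finset.mul_sum]
    refine Finset.sum_congr rfl fun k hk => ?_
    have hk2 : 2 * k ≤ n := by have := Finset.mem_range.1 hk; omega
    obtain ⟨m, rfl⟩ := Nat.exists_eq_add_of_le hk2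
    have em : 2 * k + m - 2 * k = m := by omega
    have e1 : 2 * -x = (-1) * (2 * x) := by ring
    rw [em, e1, mul_pow (-1 : ℝ), pow_add, pow_mul]; norm_num; ring
  have hsum : (∑ k ∈ Finset.range (n / 2 + 1), ((-1 : ℝ) ^ k * Real.sqrt 2 ^ (n - 2 * k) /
        (Real.sqrt 2 ^ (2 * k) * k.factorial * gammaGen ν (n - 2 * k))) *
          x ^ (n - 2 * k) * (2 * x ^ 2 - ((n - 2 * k : ℕ) : ℝ) - (2 * α + 1) * theta n)) =
      ((2 * x ^ 2 - (2 * α + 1) * theta n) * S x - x * S') / Real.sqrt 2 ^ n := by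
    rw [hxS]
    simp only [S]
    rw [Finset.mul_sum, ← Finset.sum_sub_distrib, Finset.sum_div]
    refine Finset.sum_congr rfl fun k hk => ?_
    have hk2 : 2 * k ≤ n := by have := Finset.mem_range.1 hk; omega
    have hg := (gammaGen_pos hν0 (n - 2 * k)).ne'
    have hf : (k.factorial : ℝ) ≠ 0 := by exact_mod_cast (Nat.factorial_pos k).ne'
    obtain ⟨m, rfl⟩ := Nat.exists_eq_add_of_le hk2
    have em : 2 * k + m - 2 * k = m := by omega
    rw [em] at hg ⊢
    have e2 : (2 * x) ^ m = Real.sqrt 2 ^ m * Real.sqrt 2 ^ m * x ^ m := by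
      rw [← mul_pow, ← mul_pow, ← sq, h22]
    rw [e2, pow_add]
    field_simp
    ring
  have hroot : Real.sqrt (1 / Real.Gamma (α + 1)) * Real.sqrt (gammaGen ν n) =
      C * Real.sqrt 2 ^ n := by
    rw [hC, div_mul_cancel₀ _ (by positivity), hν1, ← Real.sqrt_mul (by rw [← hν1]; positivity)]
    congr 1; ring
  have hex : Real.exp (-(-x) ^ 2 / 2) = Real.exp (-x ^ 2 / 2) := by rw [neg_sq]
  rw [hsum, hder, hphi, hphi, hSneg, hex]
  have : ∀ A : ℝ, Real.sqrt (1 / Real.Gamma (α + 1)) * 1 * 1 * Real.exp (-x ^ 2 / 2) *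
      Real.sqrt (gammaGen ν n) * (A / Real.sqrt 2 ^ n) = C * Real.exp (-x ^ 2 / 2) * A := by
    intro A
    calc _ = (Real.sqrt (1 / Real.Gamma (α + 1)) * Real.sqrt (gammaGen ν n)) *
        Real.exp (-x ^ 2 / 2) * (A / Real.sqrt 2 ^ n) := by ring
      _ = _ := by rw [hroot]; field_simp
  rw [this]
  generalize Real.exp (-x ^ 2 / 2) = E
  rcases theta_cases n with ⟨t1, t2⟩ | ⟨t1, t2⟩ <;> rw [t1, t2, hν] <;> field_simp <;> ring

/-- limit of the creation operator to the Calogero creation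
operator `(1/√2)(-Λ_{α+1/2} + x)`. -/
theorem stmt_19 (α : ℝ) (hα : -1 < α) (n : ℕ) (x : ℝ) (hx : x ≠ 0) :
    Tendsto (fun q : ℝ =>
        (1 - q ^ 2) ^ ((α + 1) / 2) *
          (q ^ (2 * α + 3 / 2) / (Real.sqrt (1 - q) * Real.sqrt (1 - q ^ 2) * x)) *
          (Real.sqrt (1 + q ^ (-(2 * α + 1)) * (1 - q ^ 2) * x ^ 2) *
              phiQ q α n (q * (Real.sqrt (1 - q ^ 2) * x)) -
            q ^ (-((2 * α + 1) * theta n)) * phiQ q α n (Real.sqrt (1 - q ^ 2) * x)))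
      (nhdsWithin 1 (Set.Ioo 0 1))
      (nhds (1 / Real.sqrt 2 *
        (-deriv (phiGen (α + 1 / 2) n) x -
          (α + 1 / 2) / x * (phiGen (α + 1 / 2) n x - phiGen (α + 1 / 2) n (-x)) +
          x * phiGen (α + 1 / 2) n x))) := by
  rw [rhs_eq hα n hx]
  have hv : Tendsto (fun q : ℝ => Real.sqrt (1 + q)) (nhdsWithin 1 (Set.Ioo 0 1))
      (nhds (Real.sqrt 2)) := by
    have := (tendsto_id_one.const_add 1).sqrt
    rwa [one_add_one_eq_two] at this
  have hs := tendsto_finsetSum (Finset.range (n / 2 + 1)) fun k _ =>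
    ((tendsto_aCoef hα n k).mul_const (x ^ (n - 2 * k))).mul (tendsto_bCoef α x n (n - 2 * k))
  have h := (((((((tendsto_cAlpha hα).mul (tendsto_rpow_one (2 * α + 3 / 2))).mul
    (tendsto_rpow_one ((n : ℝ) ^ 2 / 2))).mul (tendsto_omega α x)).mul
    (tendsto_qFact hα n).sqrt).mul hs).div (hv.mul_const x)
    (mul_ne_zero (Real.sqrt_pos.2 two_pos).ne' hx))
  refine h.congr' ?_
  filter_upwards [ev_Ioo] with q hq
  exact (lhs_eq hq.1 hq.2 hα n hx).symm
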